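/- Let R be a commutative Noetherian ring and I an integrally closed ideal of R containing a nonzerodivisor, and suppose I^2 = tI for some t ∈ I. Then I = R : (R : I); that is, I is a divisorial (reflexive) ideal. -/

import Mathlib

/-- `x` is integral over the ideal `I`: there are `n ≥ 1` and `a_i ∈ I^i` with
`x^n + a_1 x^{n-1} + ... + a_n = 0`. -/
def IsIntegralOverIdeal {R : Type*} [CommRing R] (I : Ideal R) (x : R) : Prop :=
  ∃ n : ℕ, 0 < n ∧ ∃ a : ℕ → R, (∀ i, 1 ≤ i → i ≤ n → a i ∈ I ^ i) ∧
    x ^ n + ∑ i ∈ Finset.Icc 1 n, a i * x ^ (n - i) = 0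

/-- An ideal is integrally closed if it contains every element integral over it. -/
def IsIntegrallyClosedIdeal {R : Type*} [CommRing R] (I : Ideal R) : Prop :=
  ∀ x : R, IsIntegralOverIdeal I x → x ∈ I

/-- The image of an ideal of `R` in the total ring of fractions `Q(R)`,
as an `R`-submodule of `Q(R)`. -/
noncomputable def idealImage {R : Type*} [CommRing R] (I : Ideal R) :
    Submodule R (FractionRing R) :=
  Submodule.map (Algebra.linearMap R (FractionRing R)) I

/-- If `x = t * α` in a faithful `R`-algebra with `t ∈ I` and `α` integral over `R`,
then `x` is integral over the ideal `I`. -/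
theorem isIntegralOverIdeal_of_algebraMap_eq_mul {R S : Type*} [CommRing R] [CommRing S]
    [Algebra R S] (hinj : Function.Injective (algebraMap R S)) {I : Ideal R} {t x : R}
    (ht : t ∈ I) {α : S} (hα : IsIntegral R α)
    (hx : algebraMap R S x = algebraMap R S t * α) : IsIntegralOverIdeal I x := by
  rcases subsingleton_or_nontrivial R with _ | _
  · exact ⟨1, one_pos, 0, by simp, Subsingleton.elim _ _⟩
  obtain ⟨p, hp, hpα⟩ := hα
  have := hinj.nontrivial
  have hdeg : 0 < p.natDegree := by
    refine Nat.pos_of_ne_zero fun h => ?_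
    simp [hp.natDegree_eq_zero.mp h] at hpα
  have hroot : (p.scaleRoots t).eval x = 0 := by
    apply hinj
    rw [← Polynomial.aeval_algebraMap_apply_eq_algebraMap_eval, hx, map_zero]
    exact Polynomial.scaleRoots_aeval_eq_zero hpα
  refine ⟨p.natDegree, hdeg, fun i => p.coeff (p.natDegree - i) * t ^ i,
    fun i _ _ => Ideal.mul_mem_left _ _ (Ideal.pow_mem_pow ht i), ?_⟩
  rw [Polynomial.eval_eq_sum_range, Polynomial.natDegree_scaleRoots,
    ← Finset.sum_range_reflect, Finset.sum_range_succ', add_comm] at hroot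
  rw [← Finset.Ico_add_one_right_eq_Icc, Finset.sum_Ico_eq_sum_range]
  refine Eq.trans ?_ hroot
  congr 1
  · simp [hp]
  · refine Finset.sum_congr (by simp) fun k hk => ?_
    have hk' : k + 1 ≤ p.natDegree := by simpa using hk
    rw [Polynomial.coeff_scaleRoots, add_comm 1 k,
      show p.natDegree + 1 - 1 - (k + 1) = p.natDegree - (k + 1) by omega,
      Nat.sub_sub_self hk']

/-- If `I² = tI` and `I` contains a nonzerodivisor, then `t` is a nonzerodivisor. -/
theorem mem_nonZeroDivisors_of_sq_eq_span_mul {R : Type*} [CommRing R] {I : Ideal R} {t : R}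
    (hnzd : ∃ x ∈ I, x ∈ nonZeroDivisors R) (hred : I ^ 2 = Ideal.span {t} * I) :
    t ∈ nonZeroDivisors R := by
  obtain ⟨x, hxI, hx⟩ := hnzd
  have hmem : x * x ∈ Ideal.span {t} * I := by
    rw [← hred, pow_two]
    exact Ideal.mul_mem_mul hxI hxI
  obtain ⟨z, -, hz⟩ := Ideal.mem_span_singleton_mul.mp hmem
  have hxx : t * z ∈ nonZeroDivisors R := hz ▸ mul_mem hx hx
  exact (mul_mem_nonZeroDivisors.mp hxx).1

/-- The divisoriality of an integrally closed ideal with a principal reduction of reduction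
number one, in an arbitrary model `K` of the total ring of fractions. -/
theorem map_eq_one_div_one_div_of_sq_eq_span_mul {R : Type*} (K : Type*) [CommRing R] [CommRing K]
    [Algebra R K] [IsFractionRing R K] [IsNoetherianRing R] {I : Ideal R}
    (hcl : IsIntegrallyClosedIdeal I) (hnzd : ∃ x ∈ I, x ∈ nonZeroDivisors R)
    {t : R} (ht : t ∈ I) (hred : I ^ 2 = Ideal.span {t} * I) :
    Submodule.map (Algebra.linearMap R K) I =
      1 / (1 / Submodule.map (Algebra.linearMap R K) I) := by
  have htnzd := mem_nonZeroDivisors_of_sq_eq_span_mul hnzd hred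
  set φ := algebraMap R K with hφ
  have hinj : Function.Injective φ := IsFractionRing.injective R K
  obtain ⟨u, hu⟩ : ∃ u, φ t * u = 1 :=
    (IsLocalization.map_units K ⟨t, htnzd⟩).exists_right_inv
  set J := 1 / Submodule.map (Algebra.linearMap R K) I with hJ
  have mem_dual : ∀ z, z ∈ J ↔ ∀ i ∈ I, ∃ r, φ r = z * φ i := by
    simp [hJ, Submodule.mem_div_iff_forall_mul_mem, Submodule.mem_one, hφ]
  apply le_antisymm
  · exact fun y hy z hz => mul_comm z y ▸ hz y hy
  intro y hy
  have hy' : ∀ z ∈ J, ∃ r, φ r = y * z := fun z hz =>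
    Submodule.mem_one.mp (Submodule.mem_div_iff_forall_mul_mem.mp hy z hz)
  have hone : (1 : K) ∈ J :=
    (mem_dual 1).mpr fun i _ => ⟨i, (one_mul _).symm⟩
  have hscale : ∀ z ∈ J, ∀ i ∈ I, u * φ i * z ∈ J := by
    intro z hz i hi
    refine (mem_dual _).mpr fun j hj => ?_
    have hij : i * j ∈ Ideal.span {t} * I := by
      rw [← hred, pow_two]
      exact Ideal.mul_mem_mul hi hj
    obtain ⟨k, hk, hkij⟩ := Ideal.mem_span_singleton_mul.mp hij
    obtain ⟨r, hr⟩ := (mem_dual z).mp hz k hk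
    have hmap : φ t * φ k = φ i * φ j := by rw [← map_mul, hkij, map_mul]
    exact ⟨r, by linear_combination hr - z * φ k * hu + u * z * hmap⟩
  have hpow : ∀ n : ℕ, (u * y) ^ n ∈ J := by
    intro n
    induction n with
    | zero => simpa using hone
    | succ n ih =>
      refine (mem_dual _).mpr fun i hi => ?_
      obtain ⟨r, hr⟩ := hy' _ (hscale _ ih i hi)
      exact ⟨r, by rw [hr]; ring⟩
  have hint : IsIntegral R (u * y) := by
    refine IsAlmostIntegral.isIntegral_of_nonZeroDivisors_le_comap ⟨t, htnzd, fun n => ?_⟩ ?_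
    · obtain ⟨r, hr⟩ := (mem_dual _).mp (hpow n) t ht
      exact ⟨r, by rw [Algebra.smul_def, mul_comm]; exact hr⟩
    · exact fun r hr =>
        (IsLocalization.map_units K ⟨r, hr⟩).mem_nonZeroDivisors
  obtain ⟨x, hx⟩ := hy' 1 hone
  rw [mul_one] at hx
  refine ⟨x, hcl x (isIntegralOverIdeal_of_algebraMap_eq_mul hinj ht hint ?_), hx⟩
  linear_combination hx - y * hu

/-- Let `R` be a commutative Noetherian ring and `I` an integrally closed ideal of `R`
containing a nonzerodivisor, and suppose `I² = tI` for some `t ∈ I`. Then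
`I = R : (R : I)` (inside `Q(R)`, where `R : J` denotes `{α ∈ Q(R) | αJ ⊆ R}`); that is,
`I` is a divisorial (reflexive) ideal. -/
theorem integrally_closed_principal_reduction_divisorial {R : Type} [CommRing R]
    [IsNoetherianRing R] (I : Ideal R) (hcl : IsIntegrallyClosedIdeal I)
    (hnzd : ∃ x ∈ I, x ∈ nonZeroDivisors R)
    (t : R) (ht : t ∈ I) (hred : I ^ 2 = Ideal.span {t} * I) :
    idealImage I = 1 / (1 / idealImage I) := by
  exact map_eq_one_div_one_div_of_sq_eq_span_mul (FractionRing R) hcl hnzd ht hred
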